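/- Let U be a deterministic utility field on [0,T] with conjugate field V, and define AE[U] = limsup_{x→∞} sup_{t∈[0,T]} (x ∂₂U(t,x) / U(t,x)); assume AE[U] < 1. Define Γ₃ = {γ > 0 : there exists y₀ > 0 such that for all t ∈ [0,T], all ρ ∈ (0,1) and all y ∈ (0,y₀], V(t,ρy) < ρ^{−γ/(1−γ)} V(t,y)} and Γ₄ = {γ > 0 : there exists y₀ > 0 such that for all t ∈ [0,T] and all y ∈ (0,y₀], −∂₂V(t,y) < (γ/(1−γ)) · V(t,y)/y}. Then inf Γ₃ = inf Γ₄ = AE[U]. -/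

import Mathlib

open MeasureTheory Filter Set

noncomputable section

/-- A utility function `u` on `(0,∞)` with (continuous) derivative `u'`. -/
structure IsUtilityFun (u u' : ℝ → ℝ) : Prop where
  strictConcave : StrictConcaveOn ℝ (Set.Ioi (0:ℝ)) u
  strictMono : StrictMonoOn u (Set.Ioi (0:ℝ))
  hasDeriv : ∀ x ∈ Set.Ioi (0:ℝ), HasDerivAt u (u' x) x
  derivCont : ContinuousOn u' (Set.Ioi (0:ℝ))
  inada_zero : Filter.Tendsto u' (nhdsWithin 0 (Set.Ioi 0)) Filter.atTop
  inada_infty : Filter.Tendsto u' Filter.atTop (nhds 0)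

/-- A deterministic utility field `U` on `[0,T]`. -/
structure IsUtilityField (T : ℝ) (U U' : ℝ → ℝ → ℝ) : Prop where
  jointlyMeasurable : Measurable (fun p : ℝ × ℝ => U p.1 p.2)
  utility : ∀ t ∈ Set.Icc (0:ℝ) T, IsUtilityFun (U t) (U' t)
  marginal_bounds : ∃ K₁ K₂ : ℝ → ℝ,
    ContinuousOn K₁ (Set.Ioi 0) ∧ ContinuousOn K₂ (Set.Ioi 0) ∧
    StrictAntiOn K₁ (Set.Ioi 0) ∧ StrictAntiOn K₂ (Set.Ioi 0) ∧
    (∀ x > (0:ℝ), 0 < K₁ x) ∧ (∀ x > (0:ℝ), 0 < K₂ x) ∧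
    (∀ t ∈ Set.Icc (0:ℝ) T, ∀ x > (0:ℝ), K₁ x ≤ U' t x ∧ U' t x ≤ K₂ x) ∧
    (∃ M : ℝ, ∀ᶠ x in Filter.atTop, K₂ x / K₁ x ≤ M)
  bounded_at_one : ∃ M : ℝ, ∀ t ∈ Set.Icc (0:ℝ) T, |U t 1| ≤ M
  eventually_pos : ∃ ε > (0:ℝ), ∃ x₀ : ℝ, ∀ x ≥ x₀, ∀ t ∈ Set.Icc (0:ℝ) T, ε ≤ U t x

/-- The conjugate field `V(t,y) = sup_{x>0} (U(t,x) - x y)` of a utility field. -/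
def conjugateField (U : ℝ → ℝ → ℝ) (t y : ℝ) : ℝ :=
  sSup {z | ∃ x > (0:ℝ), z = U t x - x * y}

/-- The asymptotic elasticity
`AE[U] = limsup_{x→∞} sup_{t∈[0,T]} x ∂₂U(t,x) / U(t,x)`. -/
def asymptoticElasticity (T : ℝ) (U U' : ℝ → ℝ → ℝ) : ℝ :=
  Filter.limsup (fun x => sSup ((fun t => x * U' t x / U t x) '' Set.Icc (0:ℝ) T))
    Filter.atTop

/-- A utility function lies below each of its tangents. -/
theorem IsUtilityFun.le_tangent {u u' : ℝ → ℝ} (h : IsUtilityFun u u') {x z : ℝ}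
    (hx : 0 < x) (hz : 0 < z) : u z ≤ u x + u' x * (z - x) := by
  have hc := h.strictConcave.concaveOn
  rcases lt_trichotomy x z with hlt | rfl | hlt
  · have key := hc.slope_le_of_hasDerivAt hx hz hlt (h.hasDeriv x hx)
    rw [slope_def_field, div_le_iff₀ (sub_pos.2 hlt)] at key
    linarith
  · simp
  · have key := hc.le_slope_of_hasDerivAt hz hx hlt (h.hasDeriv x hx)
    rw [slope_def_field, le_div_iff₀ (sub_pos.2 hlt)] at key
    linarith

/-- The marginal utility is nonincreasing. -/
theorem IsUtilityFun.deriv_antitoneOn {u u' : ℝ → ℝ} (h : IsUtilityFun u u') :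
    AntitoneOn u' (Set.Ioi 0) := by
  intro x hx z hz hxz
  rcases hxz.eq_or_lt with rfl | hlt
  · exact le_rfl
  · have h₁ := h.le_tangent hx hz
    have h₂ := h.le_tangent hz hx
    nlinarith

/-- By the Inada conditions the marginal utility takes every positive value. -/
theorem IsUtilityFun.exists_deriv_eq {u u' : ℝ → ℝ} (h : IsUtilityFun u u') {y : ℝ}
    (hy : 0 < y) : ∃ x > (0 : ℝ), u' x = y := by
  have hl : (atTop : Filter ℝ) ≤ Filter.principal (Set.Ioi 0) :=
    Filter.le_principal_iff.2 (Ioi_mem_atTop 0)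
  exact isPreconnected_Ioi.intermediate_value_Ioi
    (l₂ := nhdsWithin 0 (Set.Ioi 0)) hl inf_le_right h.derivCont
    h.inada_infty h.inada_zero hy

section Conjugate

variable {U U' : ℝ → ℝ → ℝ} {t : ℝ}

theorem conjugateField_bddAbove (h : IsUtilityFun (U t) (U' t)) {y : ℝ} (hy : 0 < y) :
    BddAbove {z | ∃ x > (0 : ℝ), z = U t x - x * y} := by
  obtain ⟨x, hx, rfl⟩ := h.exists_deriv_eq hy
  refine ⟨U t x - x * U' t x, ?_⟩
  rintro _ ⟨z, hz, rfl⟩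
  linarith [h.le_tangent hx hz]

theorem le_conjugateField (h : IsUtilityFun (U t) (U' t)) {x y : ℝ} (hx : 0 < x) (hy : 0 < y) :
    U t x - x * y ≤ conjugateField U t y :=
  le_csSup (conjugateField_bddAbove h hy) ⟨x, hx, rfl⟩

/-- The supremum defining the conjugate at `U' t x` is attained at `x`. -/
theorem conjugateField_deriv (h : IsUtilityFun (U t) (U' t)) {x : ℝ} (hx : 0 < x)
    (hy : 0 < U' t x) : conjugateField U t (U' t x) = U t x - x * U' t x := by
  refine le_antisymm (csSup_le ⟨_, x, hx, rfl⟩ ?_) (le_conjugateField h hx hy)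
  rintro _ ⟨z, hz, rfl⟩
  linarith [h.le_tangent hx hz]

/-- The derivative of the conjugate at `U' t x` is `-x`. -/
theorem HasDerivAt.conjugateField_eq_neg (h : IsUtilityFun (U t) (U' t)) {x v : ℝ} (hx : 0 < x)
    (hy : 0 < U' t x) (hv : HasDerivAt (conjugateField U t) v (U' t x)) : v = -x := by
  have hd : HasDerivAt (fun y => conjugateField U t y + x * y) (v + x * 1) (U' t x) :=
    hv.add ((hasDerivAt_id (U' t x)).const_mul x)
  have hmin : IsLocalMin (fun y => conjugateField U t y + x * y) (U' t x) := by
    filter_upwards [Ioi_mem_nhds hy] with y hy'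
    have := le_conjugateField h hx (show 0 < y from hy')
    have := conjugateField_deriv h hx hy
    linarith
  linarith [hmin.hasDerivAt_eq_zero hd]

end Conjugate

section Field

variable {T : ℝ} {U U' : ℝ → ℝ → ℝ}

theorem IsUtilityField.deriv_pos (hU : IsUtilityField T U U') {t x : ℝ}
    (ht : t ∈ Set.Icc (0 : ℝ) T) (hx : 0 < x) : 0 < U' t x := by
  obtain ⟨K₁, K₂, -, -, -, -, hK₁, -, hK, -⟩ := hU.marginal_bounds
  exact (hK₁ x hx).trans_le (hK t ht x hx).1

/-- The marginal utility is bounded away from `0` uniformly in time. -/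
theorem IsUtilityField.exists_pos_le_deriv (hU : IsUtilityField T U U') {x : ℝ} (hx : 0 < x) :
    ∃ k > (0 : ℝ), ∀ t ∈ Set.Icc (0 : ℝ) T, k ≤ U' t x := by
  obtain ⟨K₁, K₂, -, -, -, -, hK₁, -, hK, -⟩ := hU.marginal_bounds
  exact ⟨K₁ x, hK₁ x hx, fun t ht => (hK t ht x hx).1⟩

/-- The marginal utility tends to `0` at infinity uniformly in time. -/
theorem IsUtilityField.eventually_deriv_lt (hU : IsUtilityField T U U') (hT : 0 ≤ T) {y : ℝ}
    (hy : 0 < y) : ∀ᶠ x in atTop, ∀ t ∈ Set.Icc (0 : ℝ) T, U' t x < y := by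
  obtain ⟨K₁, K₂, -, -, -, -, hK₁, -, hK, M, hM⟩ := hU.marginal_bounds
  have h0 : (0 : ℝ) ∈ Set.Icc (0 : ℝ) T := ⟨le_rfl, hT⟩
  have hlim : Tendsto (fun x => M * U' 0 x) atTop (nhds 0) := by
    simpa using (hU.utility 0 h0).inada_infty.const_mul M
  filter_upwards [hM, hlim.eventually_lt_const hy, eventually_gt_atTop 0] with x hx hxy hpos t ht
  have hk := hK₁ x hpos
  have h₁ := hK t ht x hpos
  have h₂ := hK 0 h0 x hpos
  have hM0 : 0 < M := by
    have : 0 < K₂ x / K₁ x := div_pos (by linarith) hk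
    linarith
  rw [div_le_iff₀ hk] at hx
  have := mul_le_mul_of_nonneg_left h₂.1 hM0.le
  linarith

/-- The elasticities are eventually bounded uniformly in time. -/
theorem IsUtilityField.exists_elasticity_le (hU : IsUtilityField T U U') :
    ∃ C : ℝ, ∀ᶠ x in atTop, ∀ t ∈ Set.Icc (0 : ℝ) T, x * U' t x / U t x ≤ C := by
  obtain ⟨ε, hε, x₀, hpos⟩ := hU.eventually_pos
  obtain ⟨M, hM⟩ := hU.bounded_at_one
  refine ⟨2 * (1 + M / ε), ?_⟩
  filter_upwards [eventually_ge_atTop x₀, eventually_ge_atTop 2] with x hx hx2 t ht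
  have hx0 : 0 < x := by linarith
  have hu := hpos x hx t ht
  have htan := (hU.utility t ht).le_tangent hx0 one_pos
  have hd := hU.deriv_pos ht hx0
  have h1 := abs_le.1 (hM t ht)
  have hM0 : 0 ≤ M := (abs_nonneg _).trans (hM t ht)
  rw [div_le_iff₀ (hε.trans_le hu)]
  have h2 : M ≤ M / ε * U t x := by
    rw [div_mul_eq_mul_div, le_div_iff₀ hε]
    exact mul_le_mul_of_nonneg_left hu hM0
  nlinarith

theorem IsUtilityField.eventually_forall_pos (hU : IsUtilityField T U U') :
    ∀ᶠ x in atTop, ∀ t ∈ Set.Icc (0 : ℝ) T, 0 < U t x := by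
  obtain ⟨ε, hε, x₀, hpos⟩ := hU.eventually_pos
  filter_upwards [eventually_ge_atTop x₀] with x hx t ht
  exact hε.trans_le (hpos x hx t ht)

theorem IsUtilityField.eventually_sSup_elasticity_nonneg (hU : IsUtilityField T U U') :
    ∀ᶠ x in atTop, 0 ≤ sSup ((fun t => x * U' t x / U t x) '' Set.Icc (0 : ℝ) T) := by
  filter_upwards [hU.eventually_forall_pos, eventually_gt_atTop 0] with x hu hx
  apply Real.sSup_nonneg
  rintro _ ⟨t, ht, rfl⟩
  exact (div_pos (mul_pos hx (hU.deriv_pos ht hx)) (hu t ht)).le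

theorem IsUtilityField.isBoundedUnder_elasticity (hU : IsUtilityField T U U') (hT : 0 ≤ T) :
    IsBoundedUnder (· ≤ ·) atTop
      (fun x => sSup ((fun t => x * U' t x / U t x) '' Set.Icc (0 : ℝ) T)) := by
  obtain ⟨C, hC⟩ := hU.exists_elasticity_le
  refine isBoundedUnder_of_eventually_le (a := C) ?_
  filter_upwards [hC] with x hx
  refine csSup_le ((nonempty_Icc.2 hT).image _) ?_
  rintro _ ⟨t, ht, rfl⟩
  exact hx t ht

theorem IsUtilityField.asymptoticElasticity_nonneg (hU : IsUtilityField T U U') (hT : 0 ≤ T) :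
    0 ≤ asymptoticElasticity T U U' :=
  le_limsup_of_frequently_le hU.eventually_sSup_elasticity_nonneg.frequently
    (hU.isBoundedUnder_elasticity hT)

theorem IsUtilityField.eventually_lt_of_asymptoticElasticity_lt (hU : IsUtilityField T U U')
    (hT : 0 ≤ T) {γ : ℝ} (hγ : asymptoticElasticity T U U' < γ) :
    ∀ᶠ x in atTop, ∀ t ∈ Set.Icc (0 : ℝ) T, x * U' t x < γ * U t x := by
  obtain ⟨C, hC⟩ := hU.exists_elasticity_le
  filter_upwards [eventually_lt_of_limsup_lt hγ (hU.isBoundedUnder_elasticity hT), hC,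
    hU.eventually_forall_pos] with x hlt hb hu t ht
  rw [← div_lt_iff₀ (hu t ht)]
  refine lt_of_le_of_lt (le_csSup ⟨C, ?_⟩
    (Set.mem_image_of_mem (fun t => x * U' t x / U t x) ht)) hlt
  rintro _ ⟨s, hs, rfl⟩
  exact hb s hs

theorem IsUtilityField.asymptoticElasticity_le (hU : IsUtilityField T U U') (hT : 0 ≤ T) {γ : ℝ}
    (h : ∀ᶠ x in atTop, ∀ t ∈ Set.Icc (0 : ℝ) T, x * U' t x ≤ γ * U t x) :
    asymptoticElasticity T U U' ≤ γ := by
  refine limsup_le_of_le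
    (isCoboundedUnder_le_of_eventually_le _ hU.eventually_sSup_elasticity_nonneg) ?_
  filter_upwards [h, hU.eventually_forall_pos] with x hx hu
  refine csSup_le ((nonempty_Icc.2 hT).image _) ?_
  rintro _ ⟨t, ht, rfl⟩
  exact (div_le_iff₀ (hu t ht)).2 (hx t ht)

variable {V' : ℝ → ℝ → ℝ}

/-- Every `γ < 1` above the asymptotic elasticity satisfies the differential bound on the
conjugate. -/
theorem IsUtilityField.exists_neg_deriv_conjugateField_lt (hU : IsUtilityField T U U')
    (hT : 0 ≤ T)
    (hV' : ∀ t ∈ Set.Icc (0 : ℝ) T, ∀ y > (0 : ℝ), HasDerivAt (conjugateField U t) (V' t y) y)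
    {γ : ℝ} (hγ : asymptoticElasticity T U U' < γ) (hγ1 : γ < 1) :
    ∃ y₀ > (0 : ℝ), ∀ t ∈ Set.Icc (0 : ℝ) T, ∀ y ∈ Set.Ioc (0 : ℝ) y₀,
      -(V' t y) < (γ / (1 - γ)) * (conjugateField U t y / y) := by
  obtain ⟨x₁, hx₁⟩ := eventually_atTop.1 (hU.eventually_lt_of_asymptoticElasticity_lt hT hγ)
  obtain ⟨k, hk, hkU⟩ := hU.exists_pos_le_deriv (lt_max_of_lt_right one_pos : 0 < max x₁ 1)
  refine ⟨k / 2, by positivity, fun t ht y hy => ?_⟩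
  have hu := hU.utility t ht
  obtain ⟨x, hx, rfl⟩ := hu.exists_deriv_eq hy.1
  have hxx : x₁ ≤ x := by
    by_contra! hlt
    have := hu.deriv_antitoneOn (a := x) (b := max x₁ 1) hx
      (Set.mem_Ioi.2 (lt_max_of_lt_right one_pos)) (hlt.le.trans (le_max_left _ _))
    linarith [hkU t ht, hy.2]
  rw [(hV' t ht _ hy.1).conjugateField_eq_neg hu hx hy.1, conjugateField_deriv hu hx hy.1,
    neg_neg, div_mul_div_comm, lt_div_iff₀ (mul_pos (by linarith) hy.1)]
  nlinarith [hx₁ x hxx t ht]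

/-- A weak form of the differential bound on the conjugate bounds the asymptotic elasticity. -/
theorem IsUtilityField.asymptoticElasticity_le_of_neg_deriv_conjugateField_le
    (hU : IsUtilityField T U U') (hT : 0 ≤ T)
    (hV' : ∀ t ∈ Set.Icc (0 : ℝ) T, ∀ y > (0 : ℝ), HasDerivAt (conjugateField U t) (V' t y) y)
    {γ y₀ : ℝ} (hγ1 : γ < 1) (hy₀ : 0 < y₀)
    (h : ∀ t ∈ Set.Icc (0 : ℝ) T, ∀ y ∈ Set.Ioo (0 : ℝ) y₀,
      -(V' t y) ≤ (γ / (1 - γ)) * (conjugateField U t y / y)) :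
    asymptoticElasticity T U U' ≤ γ := by
  refine hU.asymptoticElasticity_le hT ?_
  filter_upwards [hU.eventually_deriv_lt hT hy₀, eventually_gt_atTop 0] with x hxy hx t ht
  have hu := hU.utility t ht
  have hd := hU.deriv_pos ht hx
  have key := h t ht _ ⟨hd, hxy t ht⟩
  rw [(hV' t ht _ hd).conjugateField_eq_neg hu hx hd, conjugateField_deriv hu hx hd,
    neg_neg, div_mul_div_comm, le_div_iff₀ (mul_pos (by linarith) hd)] at key
  nlinarith

end Field

section PowerWeight

variable {f f' : ℝ → ℝ} {c y₀ : ℝ}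

theorem hasDerivAt_mul_rpow {y v : ℝ} (hy : 0 < y) (hf : HasDerivAt f v y) :
    HasDerivAt (fun z => f z * z ^ c) (y ^ c * (v + c * (f y / y))) y := by
  have := hf.mul (Real.hasDerivAt_rpow_const (p := c) (Or.inl hy.ne'))
  refine this.congr_deriv ?_
  rw [Real.rpow_sub_one hy.ne']
  field_simp

/-- Under the strict differential bound, scaling the argument by `ρ < 1` increases `f` by a
factor less than `ρ ^ (-c)`. -/
theorem lt_rpow_neg_mul_of_neg_deriv_lt (hf : ∀ y > (0 : ℝ), HasDerivAt f (f' y) y)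
    (h : ∀ y ∈ Set.Ioc (0 : ℝ) y₀, -(f' y) < c * (f y / y)) {ρ y : ℝ}
    (hρ : ρ ∈ Set.Ioo (0 : ℝ) 1) (hy : y ∈ Set.Ioc (0 : ℝ) y₀) :
    f (ρ * y) < ρ ^ (-c) * f y := by
  have hmono : StrictMonoOn (fun z => f z * z ^ c) (Set.Ioc 0 y₀) := by
    refine strictMonoOn_of_hasDerivWithinAt_pos (convex_Ioc 0 y₀)
      (f' := fun z => z ^ c * (f' z + c * (f z / z))) ?_ ?_ ?_
    · exact fun z hz =>
        (hasDerivAt_mul_rpow hz.1 (hf z hz.1)).continuousAt.continuousWithinAt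
    · intro z hz
      have hz' := interior_subset hz
      exact (hasDerivAt_mul_rpow hz'.1 (hf z hz'.1)).hasDerivWithinAt
    · intro z hz
      have hz' := interior_subset hz
      exact mul_pos (Real.rpow_pos_of_pos hz'.1 c) (by linarith [h z hz'])
  have hlt : ρ * y < y := by nlinarith [hρ.2, hy.1]
  have key := hmono ⟨mul_pos hρ.1 hy.1, hlt.le.trans hy.2⟩ hy hlt
  simp only [Real.mul_rpow hρ.1.le hy.1.le] at key
  have hyc := Real.rpow_pos_of_pos hy.1 c
  have hρc := Real.rpow_pos_of_pos hρ.1 c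
  rw [Real.rpow_neg hρ.1.le, inv_mul_eq_div, lt_div_iff₀ hρc]
  nlinarith

/-- Conversely, the scaling bound implies the weak differential bound. -/
theorem neg_deriv_le_of_lt_rpow_neg_mul (hf : ∀ y > (0 : ℝ), HasDerivAt f (f' y) y)
    (h : ∀ ρ ∈ Set.Ioo (0 : ℝ) 1, ∀ y ∈ Set.Ioc (0 : ℝ) y₀, f (ρ * y) < ρ ^ (-c) * f y)
    {y : ℝ} (hy : y ∈ Set.Ioo (0 : ℝ) y₀) : -(f' y) ≤ c * (f y / y) := by
  have hmono : MonotoneOn (fun z => f z * z ^ c) (Set.Ioo 0 y₀) := by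
    intro z hz w hw hzw
    rcases hzw.eq_or_lt with rfl | hlt
    · exact le_rfl
    have key := h (z / w) ⟨div_pos hz.1 hw.1, (div_lt_one hw.1).2 hlt⟩ w ⟨hw.1, hw.2.le⟩
    have hzc := Real.rpow_pos_of_pos hz.1 c
    have hwc := Real.rpow_pos_of_pos hw.1 c
    rw [div_mul_cancel₀ _ hw.1.ne', Real.rpow_neg (div_pos hz.1 hw.1).le,
      Real.div_rpow hz.1.le hw.1.le, inv_div, div_mul_eq_mul_div, lt_div_iff₀ hzc] at key
    simpa [mul_comm (w ^ c)] using key.le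
  have hnn := hmono.derivWithin_nonneg (x := y)
  rw [(hasDerivAt_mul_rpow hy.1 (hf y hy.1)).hasDerivWithinAt.derivWithin
    (isOpen_Ioo.uniqueDiffWithinAt hy)] at hnn
  have := nonneg_of_mul_nonneg_right hnn (Real.rpow_pos_of_pos hy.1 c)
  linarith

end PowerWeight

theorem sInf_eq_of_Ioo_subset {S : Set ℝ} {a b : ℝ} (hab : a < b) (hS : Set.Ioo a b ⊆ S)
    (ha : a ∈ lowerBounds S) : sInf S = a :=
  ((isGLB_Ioo hab).of_subset_of_superset (isGLB_Ici) hS ha).csInf_eq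
    ((Set.nonempty_Ioo.2 hab).mono hS)

/-- For a reasonably elastic utility field, in terms of the
conjugate field `V` (with partial derivative `∂₂V = V'`),
`inf Γ₃ = inf Γ₄ = AE[U]`. -/
theorem asymptotic_elasticity_dual_characterization
    (T : ℝ) (hT : 0 < T) (U U' : ℝ → ℝ → ℝ) (hU : IsUtilityField T U U')
    (hAE : asymptoticElasticity T U U' < 1)
    (V' : ℝ → ℝ → ℝ)
    (hV' : ∀ t ∈ Set.Icc (0:ℝ) T, ∀ y > (0:ℝ),
      HasDerivAt (conjugateField U t) (V' t y) y) :
    sInf {γ : ℝ | 0 < γ ∧ ∃ y₀ > (0:ℝ), ∀ t ∈ Set.Icc (0:ℝ) T,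
        ∀ ρ ∈ Set.Ioo (0:ℝ) 1, ∀ y ∈ Set.Ioc (0:ℝ) y₀,
        conjugateField U t (ρ * y) < ρ ^ (-γ / (1 - γ)) * conjugateField U t y}
      = asymptoticElasticity T U U' ∧
    sInf {γ : ℝ | 0 < γ ∧ ∃ y₀ > (0:ℝ), ∀ t ∈ Set.Icc (0:ℝ) T,
        ∀ y ∈ Set.Ioc (0:ℝ) y₀,
        -(V' t y) < (γ / (1 - γ)) * (conjugateField U t y / y)}
      = asymptoticElasticity T U U' := by
  have hT0 := hT.le
  have h0 := hU.asymptoticElasticity_nonneg hT0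
  constructor
  · refine sInf_eq_of_Ioo_subset hAE ?_ ?_
    · rintro γ ⟨hγ, hγ1⟩
      obtain ⟨y₀, hy₀, h⟩ := hU.exists_neg_deriv_conjugateField_lt hT0 hV' hγ hγ1
      refine ⟨h0.trans_lt hγ, y₀, hy₀, fun t ht ρ hρ y hy => ?_⟩
      rw [neg_div]
      exact lt_rpow_neg_mul_of_neg_deriv_lt (hV' t ht) (h t ht) hρ hy
    · rintro γ ⟨-, y₀, hy₀, h⟩
      rcases lt_or_ge γ 1 with hγ1 | hγ1
      · refine hU.asymptoticElasticity_le_of_neg_deriv_conjugateField_le hT0 hV' hγ1 hy₀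
          fun t ht y hy => neg_deriv_le_of_lt_rpow_neg_mul (hV' t ht) (fun ρ hρ z hz => ?_) hy
        rw [← neg_div]
        exact h t ht ρ hρ z hz
      · exact hAE.le.trans hγ1
  · refine sInf_eq_of_Ioo_subset hAE ?_ ?_
    · rintro γ ⟨hγ, hγ1⟩
      exact ⟨h0.trans_lt hγ, hU.exists_neg_deriv_conjugateField_lt hT0 hV' hγ hγ1⟩
    · rintro γ ⟨-, y₀, hy₀, h⟩
      rcases lt_or_ge γ 1 with hγ1 | hγ1
      · exact hU.asymptoticElasticity_le_of_neg_deriv_conjugateField_le hT0 hV' hγ1 hy₀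
          fun t ht y hy => (h t ht y ⟨hy.1, hy.2.le⟩).le
      · exact hAE.le.trans hγ1

end
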